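/- For every fixed x < 0, the normalized Black-Scholes call price has the small-volatility asymptotics lim_{v→0⁺} c(x,v)·x² / (φ(x/v)·v³) = 1, where φ(z) = (1/√(2π))·e^{−z²/2} is the standard normal density. -/

import Mathlib

open Real Set Filter

/-- The standard normal cumulative distribution function Φ. -/
noncomputable def stdNormalCDF (y : ℝ) : ℝ :=
  (Real.sqrt (2 * Real.pi))⁻¹ * ∫ t in Set.Iic y, Real.exp (-t ^ 2 / 2)

/-- The normalized Black-Scholes call price
`c(x,v) = e^{x/2} Φ(x/v + v/2) − e^{−x/2} Φ(x/v − v/2)`. -/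
noncomputable def normCall (x v : ℝ) : ℝ :=
  Real.exp (x / 2) * stdNormalCDF (x / v + v / 2) -
    Real.exp (-x / 2) * stdNormalCDF (x / v - v / 2)

/-- The standard normal density `φ(z) = (1/√(2π)) e^{−z²/2}`. -/
noncomputable def stdNormalPDF (z : ℝ) : ℝ :=
  (Real.sqrt (2 * Real.pi))⁻¹ * Real.exp (-z ^ 2 / 2)

theorem integrable_exp_neg_sq_div_two :
    MeasureTheory.Integrable fun t : ℝ => Real.exp (-t ^ 2 / 2) := by
  refine (integrable_exp_neg_mul_sq (b := 1 / 2) (by norm_num)).congr (.of_forall fun t => ?_)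
  ring_nf

theorem hasDerivAt_stdNormalCDF (y : ℝ) : HasDerivAt stdNormalCDF (stdNormalPDF y) y := by
  have hcont : Continuous fun t : ℝ => Real.exp (-t ^ 2 / 2) := by fun_prop
  have hsplit (z : ℝ) : ∫ t in Set.Iic z, Real.exp (-t ^ 2 / 2) =
      (∫ t in Set.Iic (0 : ℝ), Real.exp (-t ^ 2 / 2)) + ∫ t in (0 : ℝ)..z, Real.exp (-t ^ 2 / 2) := by
    rw [← intervalIntegral.integral_Iic_sub_Iic integrable_exp_neg_sq_div_two.integrableOn
      integrable_exp_neg_sq_div_two.integrableOn]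
    ring
  have h := (((hcont.integral_hasStrictDerivAt 0 y).hasDerivAt).const_add
    (∫ t in Set.Iic (0 : ℝ), Real.exp (-t ^ 2 / 2))).const_mul (Real.sqrt (2 * Real.pi))⁻¹
  refine h.congr_of_eventuallyEq (.of_forall fun z => ?_)
  simp only [stdNormalCDF, hsplit z]

theorem tendsto_stdNormalCDF_atBot : Tendsto stdNormalCDF atBot (nhds 0) := by
  have h := (MeasureTheory.tendsto_integral_Iic_zero (f := fun t : ℝ => Real.exp (-t ^ 2 / 2))
    (μ := MeasureTheory.volume) tendsto_id).const_mul (Real.sqrt (2 * Real.pi))⁻¹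
  rw [mul_zero] at h
  exact h

theorem stdNormalPDF_pos (z : ℝ) : 0 < stdNormalPDF z := by
  unfold stdNormalPDF
  positivity

theorem stdNormalPDF_le (z : ℝ) : stdNormalPDF z ≤ (Real.sqrt (2 * Real.pi))⁻¹ := by
  refine mul_le_of_le_one_right (by positivity) (Real.exp_le_one_iff.2 ?_)
  nlinarith [sq_nonneg z]

theorem hasDerivAt_stdNormalPDF (z : ℝ) : HasDerivAt stdNormalPDF (-z * stdNormalPDF z) z := by
  have h := ((((hasDerivAt_id z).pow 2).neg.div_const 2).exp).const_mul (Real.sqrt (2 * Real.pi))⁻¹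
  refine h.congr_deriv ?_
  simp [stdNormalPDF]
  ring

theorem hasDerivAt_const_div (x : ℝ) {v : ℝ} (hv : v ≠ 0) :
    HasDerivAt (fun w => x / w) (-x / v ^ 2) v := by
  refine ((hasDerivAt_inv hv).const_mul x).congr_deriv ?_
  ring

/-- The vega of the normalized call price is `φ(x/v) e^{−v²/8}`. -/
theorem hasDerivAt_normCall (x : ℝ) {v : ℝ} (hv : v ≠ 0) :
    HasDerivAt (normCall x) (stdNormalPDF (x / v) * Real.exp (-v ^ 2 / 8)) v := by
  have hdiv := hasDerivAt_const_div x hv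
  have hhalf := (hasDerivAt_id v).div_const 2
  have h₁ := ((hasDerivAt_stdNormalCDF (x / v + v / 2)).comp v (hdiv.add hhalf)).const_mul
    (Real.exp (x / 2))
  have h₂ := ((hasDerivAt_stdNormalCDF (x / v - v / 2)).comp v (hdiv.sub hhalf)).const_mul
    (Real.exp (-x / 2))
  have e₁ : Real.exp (x / 2) * stdNormalPDF (x / v + v / 2) =
      stdNormalPDF (x / v) * Real.exp (-v ^ 2 / 8) := by
    simp only [stdNormalPDF]
    rw [mul_left_comm, mul_assoc, ← Real.exp_add, ← Real.exp_add]
    congr 2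
    field_simp
    ring
  have e₂ : Real.exp (-x / 2) * stdNormalPDF (x / v - v / 2) =
      stdNormalPDF (x / v) * Real.exp (-v ^ 2 / 8) := by
    simp only [stdNormalPDF]
    rw [mul_left_comm, mul_assoc, ← Real.exp_add, ← Real.exp_add]
    congr 2
    field_simp
    ring
  refine (h₁.sub h₂).congr_deriv ?_
  rw [← mul_assoc, ← mul_assoc, e₁, e₂]
  ring

theorem tendsto_normCall_zero {x : ℝ} (hx : x < 0) :
    Tendsto (normCall x) (nhdsWithin 0 (Set.Ioi 0)) (nhds 0) := by
  have hdiv : Tendsto (fun v : ℝ => x / v) (nhdsWithin 0 (Set.Ioi 0)) atBot := by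
    simpa only [div_eq_mul_inv] using tendsto_inv_nhdsGT_zero.const_mul_atTop_of_neg hx
  have hhalf : Tendsto (fun v : ℝ => v / 2) (nhdsWithin 0 (Set.Ioi 0)) (nhds 0) := by
    simpa using ((continuous_id.div_const (2 : ℝ)).tendsto 0).mono_left nhdsWithin_le_nhds
  have h₁ := (tendsto_stdNormalCDF_atBot.comp (hdiv.atBot_add hhalf)).const_mul (Real.exp (x / 2))
  have h₂ := (tendsto_stdNormalCDF_atBot.comp (hdiv.atBot_add hhalf.neg)).const_mul
    (Real.exp (-x / 2))
  have h := h₁.sub h₂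
  simp only [mul_zero, sub_zero, Function.comp_def, ← sub_eq_add_neg] at h
  exact h

/-- Small-volatility asymptotics of the normalized Black-Scholes call price for `x < 0`:
`c(x,v) ≈ φ(x/v) v³/x²` as `v → 0⁺`. -/
theorem normCall_asymptotics_small_vol (x : ℝ) (hx : x < 0) :
    Filter.Tendsto (fun v => normCall x v * x ^ 2 / (stdNormalPDF (x / v) * v ^ 3))
      (nhdsWithin 0 (Set.Ioi 0)) (nhds 1) := by
  have hpos : ∀ᶠ v : ℝ in nhdsWithin 0 (Set.Ioi 0), v ≠ 0 :=
    eventually_mem_nhdsWithin.mono fun v hv => ne_of_gt hv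
  have hden (v : ℝ) : 0 < x ^ 2 + 3 * v ^ 2 := by
    have := pow_pos (neg_pos.2 hx) 2
    nlinarith [sq_nonneg v]
  refine HasDerivAt.lhopital_zero_nhdsGT
    (f' := fun v => stdNormalPDF (x / v) * Real.exp (-v ^ 2 / 8) * x ^ 2)
    (g' := fun v => stdNormalPDF (x / v) * (x ^ 2 + 3 * v ^ 2)) ?_ ?_ ?_ ?_ ?_ ?_
  · exact hpos.mono fun v hv => (hasDerivAt_normCall x hv).mul_const _
  · filter_upwards [hpos] with v hv
    refine (((hasDerivAt_stdNormalPDF (x / v)).comp v (hasDerivAt_const_div x hv)).mul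
      (hasDerivAt_pow 3 v)).congr_deriv ?_
    simp only [Function.comp_apply]
    field_simp
    push_cast
    ring
  · exact .of_forall fun v => (mul_pos (stdNormalPDF_pos _) (hden v)).ne'
  · simpa using (tendsto_normCall_zero hx).mul_const (x ^ 2)
  · have hpow : Tendsto (fun v : ℝ => v ^ 3) (nhdsWithin 0 (Set.Ioi 0)) (nhds 0) := by
      simpa using ((continuous_pow 3).tendsto (0 : ℝ)).mono_left nhdsWithin_le_nhds
    have hbound := hpow.const_mul (Real.sqrt (2 * Real.pi))⁻¹
    rw [mul_zero] at hbound
    refine squeeze_zero' ?_ ?_ hbound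
    · filter_upwards [eventually_mem_nhdsWithin] with v hv
      exact mul_nonneg (stdNormalPDF_pos _).le (pow_pos hv 3).le
    · filter_upwards [eventually_mem_nhdsWithin] with v hv
      exact mul_le_mul_of_nonneg_right (stdNormalPDF_le _) (pow_pos hv 3).le
  · have hcont : Continuous fun v : ℝ => Real.exp (-v ^ 2 / 8) * x ^ 2 / (x ^ 2 + 3 * v ^ 2) :=
      Continuous.div (by fun_prop) (by fun_prop) fun v => (hden v).ne'
    have hlim := (hcont.tendsto 0).mono_left (nhdsWithin_le_nhds (s := Set.Ioi 0))
    have hone : Real.exp (-(0 : ℝ) ^ 2 / 8) * x ^ 2 / (x ^ 2 + 3 * 0 ^ 2) = 1 := by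
      simp [hx.ne]
    rw [hone] at hlim
    refine hlim.congr fun v => ?_
    rw [mul_assoc, mul_div_mul_left _ _ (stdNormalPDF_pos _).ne']
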